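/- Assume u < v. The K-local sensitivity of f_{b,u,v} at D is 1 exactly on S(D): there exist K-neighbors D₁ and D₂ of D with count_{u,v}(D₁) > b and count_{u,v}(D₂) ≤ b if and only if count_{u,v}(D) ≤ b + K, b < count_{u,v}(D) + K, and b < D.length. -/

import Mathlib

/-- Number of entries `x` of the database column `D` with `u ≤ x` and `x < v`. -/
noncomputable def rangeCount (u v : ℝ) (D : List ℝ) : ℕ :=
  D.countP (fun x => decide (u ≤ x ∧ x < v))

/-- Number of positions at which two lists (of the same length) differ. -/
noncomputable def diffCount (D D' : List ℝ) : ℕ :=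
  (D.zip D').countP (fun p => decide (p.1 ≠ p.2))

/-- `D'` is a `K`-neighbor of `D`: same length, and at most `K` modified records. -/
def IsKNeighbor (K : ℕ) (D D' : List ℝ) : Prop :=
  D'.length = D.length ∧ diffCount D D' ≤ K

/-- The threshold query `f_{b,u,v}`: `1` if `count_{u,v}(D) > b`, else `0`. -/
noncomputable def fQuery (u v : ℝ) (b : ℕ) (D : List ℝ) : ℕ :=
  if b < rangeCount u v D then 1 else 0

/-- `S(D)`: the set of thresholds `b` at which the `K`-local sensitivity of
`f_{b,u,v}` is one. -/
def SLS (u v : ℝ) (K : ℕ) (D : List ℝ) : Set ℕ :=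
  {b : ℕ | rangeCount u v D ≤ b + K ∧ b < rangeCount u v D + K ∧ b < D.length}

theorem diffCount_self (D : List ℝ) : diffCount D D = 0 := by
  induction D with
  | nil => rfl
  | cons x D ih => simpa [diffCount] using ih

theorem diffCount_cons (x y : ℝ) (D D' : List ℝ) :
    diffCount (x :: D) (y :: D') = diffCount D D' + if x = y then 0 else 1 := by
  by_cases h : x = y <;> simp [diffCount, h]

/-- Modifying records changes a count by at most the number of modified records. -/
theorem countP_le_add_diffCount (p : ℝ → Bool) (D D' : List ℝ) (h : D'.length = D.length) :
    D'.countP p ≤ D.countP p + diffCount D D' ∧ D.countP p ≤ D'.countP p + diffCount D D' := by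
  induction D generalizing D' with
  | nil => simp_all
  | cons x D ih =>
    cases D' with
    | nil => simp at h
    | cons y D' =>
      have := ih D' (by simpa using h)
      rw [diffCount_cons, List.countP_cons, List.countP_cons]
      by_cases hxy : x = y
      · subst hxy
        simp only [if_true]
        omega
      · rw [if_neg hxy]
        split_ifs <;> omega

/-- If `p` is satisfiable, modifying `K` records can raise the `p`-count by `K`, up to the length. -/
theorem exists_isKNeighbor_le_countP (p : ℝ → Bool) (a : ℝ) (ha : p a = true) (K : ℕ)
    (D : List ℝ) :
    ∃ D', IsKNeighbor K D D' ∧ min (D.countP p + K) D.length ≤ D'.countP p := by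
  induction D generalizing K with
  | nil => exact ⟨[], ⟨rfl, by simp [diffCount]⟩, by simp⟩
  | cons x D ih =>
    by_cases hx : p x = true
    · obtain ⟨D', ⟨hl, hd⟩, hc⟩ := ih K
      refine ⟨x :: D', ⟨by simp [hl], by simpa [diffCount_cons] using hd⟩, ?_⟩
      simp only [List.countP_cons, hx, if_true, List.length_cons]
      omega
    · cases K with
      | zero => exact ⟨x :: D, ⟨rfl, (diffCount_self _).le⟩, by simp⟩
      | succ K =>
        obtain ⟨D', ⟨hl, hd⟩, hc⟩ := ih K
        refine ⟨a :: D', ⟨by simp [hl], ?_⟩, ?_⟩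
        · rw [diffCount_cons]
          split_ifs <;> omega
        · simp only [List.countP_cons, hx, ha, if_true, List.length_cons]
          simp only [Bool.false_eq_true, if_false]
          omega

theorem localSensitivity_one_iff (u v : ℝ) (huv : u < v) (K b : ℕ) (D : List ℝ) :
    ((∃ D₁ : List ℝ, IsKNeighbor K D D₁ ∧ b < rangeCount u v D₁) ∧
      (∃ D₂ : List ℝ, IsKNeighbor K D D₂ ∧ rangeCount u v D₂ ≤ b)) ↔
      b ∈ SLS u v K D := by
  simp only [SLS, Set.mem_ofPred_eq, rangeCount]
  set p : ℝ → Bool := fun x => decide (u ≤ x ∧ x < v) with hp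
  constructor
  · rintro ⟨⟨D₁, ⟨hl₁, hd₁⟩, h₁⟩, D₂, ⟨hl₂, hd₂⟩, h₂⟩
    have := countP_le_add_diffCount p D D₁ hl₁
    have := countP_le_add_diffCount p D D₂ hl₂
    have := List.countP_le_length (p := p) (l := D₁)
    omega
  · rintro ⟨h₁, h₂, h₃⟩
    constructor
    · obtain ⟨D₁, hD₁, hc⟩ := exists_isKNeighbor_le_countP p u (by simp [hp, huv]) K D
      exact ⟨D₁, hD₁, by omega⟩
    · obtain ⟨D₂, hD₂, hc⟩ :=
        exists_isKNeighbor_le_countP (fun x => !p x) v (by simp [hp]) K D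
      refine ⟨D₂, hD₂, ?_⟩
      have hD := List.length_eq_countP_add_countP p (l := D)
      have hD' := List.length_eq_countP_add_countP p (l := D₂)
      simp only [Bool.not_eq_true, Bool.decide_eq_false] at hD hD'
      have := hD₂.1
      omega
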